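/- Assume n is odd. For i ∈ I_0 and q ∈ ℕ, the map Φ_i^(q) : H_0̄ → W_1̄ defined by D_H(f) ↦ ∂_i^{p^q}(f) · D_H(x^ω) is a well-defined derivation from H_0̄ into W_1̄ of ℤ-degree n − p^q. -/

import Mathlib

open Finsupp Finset

namespace HamSup

variable (F : Type) [Field F]

/-- Monomial index: a multi-exponent for the divided power part and a set of odd indices. -/
abbrev Mono (m n : ℕ) := (Fin m → ℕ) × Finset (Fin n)

/-- The superalgebra `O(m,n)` as the free module on monomials `x^(α) x^u`. -/
abbrev O (m n : ℕ) := Mono m n →₀ F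

variable {m n : ℕ}

/-- The basis monomial `x^(α) x^u`. -/
noncomputable def X (μ : Mono m n) : O F m n := Finsupp.single μ 1

/-- Linear extension of a map defined on basis monomials. -/
noncomputable def extend {N : Type} [AddCommGroup N] [Module F N]
    (v : Mono m n → N) : O F m n →ₗ[F] N :=
  Finsupp.lsum F fun μ => LinearMap.toSpanSingleton F N (v μ)

/-- Number of inversions when concatenating `x^u` and `x^v`. -/
def invCount (u v : Finset (Fin n)) : ℕ :=
  ((u ×ˢ v).filter fun q => q.2 < q.1).card

/-- Product of two basis monomials: divided-power binomial coefficients on the even part and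
a sign (with nilpotency) on the exterior part. -/
noncomputable def mulMono (μ ν : Mono m n) : O F m n :=
  if Disjoint μ.2 ν.2 then
    (((-1 : F) ^ invCount μ.2 ν.2) * ∏ i, ((μ.1 i + ν.1 i).choose (μ.1 i) : F)) •
      X F (μ.1 + ν.1, μ.2 ∪ ν.2)
  else 0

/-- The multiplication of `O(m,n)` as a bilinear map. -/
noncomputable def mulO : O F m n →ₗ[F] O F m n →ₗ[F] O F m n :=
  extend F fun μ => extend F (mulMono F μ)

/-- Even partial derivative `∂_i`, `i ∈ I₀`. -/
noncomputable def pdE (i : Fin m) : O F m n →ₗ[F] O F m n :=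
  extend F fun μ =>
    if μ.1 i = 0 then 0 else X F (Function.update μ.1 i (μ.1 i - 1), μ.2)

/-- Odd partial derivative `∂_j`, `j ∈ I₁`. -/
noncomputable def pdO (j : Fin n) : O F m n →ₗ[F] O F m n :=
  extend F fun μ =>
    if j ∈ μ.2 then ((-1 : F) ^ (μ.2.filter fun k => k < j).card) • X F (μ.1, μ.2.erase j)
    else 0

/-- Partial derivative indexed by `I = I₀ ⊔ I₁`. -/
noncomputable def pd (i : Fin m ⊕ Fin n) : O F m n →ₗ[F] O F m n :=
  Sum.elim (pdE F) (pdO F) i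

/-- Parity `μ(i)` of an index. -/
def idxPar : Fin m ⊕ Fin n → ℕ := Sum.elim (fun _ => 0) (fun _ => 1)

/-- The sign `τ(i)`. -/
def tau (r : ℕ) : Fin m ⊕ Fin n → ℤ :=
  Sum.elim (fun i => if (i : ℕ) < r then 1 else -1) (fun _ => 1)

/-- The basis vector field `x^(α) x^u ∂_i` of the Witt superalgebra, as an endomorphism. -/
noncomputable def fD (μ : Mono m n) (i : Fin m ⊕ Fin n) : Module.End F (O F m n) :=
  (mulO F (X F μ)).comp (pd F i)

/-- `D_H(x^(α)x^u) = Σ_i τ(i)(−1)^{μ(i)p(f)} ∂_i(f) ∂_{i'}` on a basis monomial. -/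
noncomputable def DHmono (r : ℕ) (pr : Fin m ⊕ Fin n → Fin m ⊕ Fin n) (μ : Mono m n) :
    Module.End F (O F m n) :=
  ∑ i : Fin m ⊕ Fin n,
    (((tau r i : ℤ) : F) * (-1 : F) ^ (idxPar i * μ.2.card)) •
      ((mulO F (pd F i (X F μ))).comp (pd F (pr i)))

/-- The Hamiltonian map `D_H` as a linear map. -/
noncomputable def DH (r : ℕ) (pr : Fin m ⊕ Fin n → Fin m ⊕ Fin n) :
    O F m n →ₗ[F] Module.End F (O F m n) :=
  extend F (DHmono F r pr)

/-- Truncation condition `α ∈ A(m;t)`, i.e. `α_i ≤ π_i = p^{t_i} − 1`. -/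
def inA (p : ℕ) (t : Fin m → ℕ) (α : Fin m → ℕ) : Prop := ∀ i, α i < p ^ t i

/-- The tuple `π`. -/
def piF (p : ℕ) (t : Fin m → ℕ) : Fin m → ℕ := fun i => p ^ t i - 1

/-- The truncated algebra `O(m,n;t)` as a subspace. -/
noncomputable def Ot (p : ℕ) (t : Fin m → ℕ) : Submodule F (O F m n) :=
  Submodule.span F {x | ∃ μ : Mono m n, inA p t μ.1 ∧ x = X F μ}

/-- The even part `H₀̄` of the Hamiltonian superalgebra. -/
noncomputable def H0 (p r : ℕ) (t : Fin m → ℕ) (pr : Fin m ⊕ Fin n → Fin m ⊕ Fin n) :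
    Submodule F (Module.End F (O F m n)) :=
  Submodule.span F {x | ∃ μ : Mono m n, inA p t μ.1 ∧ Even μ.2.card ∧
    ¬(μ.1 = piF p t ∧ μ.2 = Finset.univ) ∧ x = DHmono F r pr μ}

/-- The codimension-one ideal `J` of `H₀̄`. -/
noncomputable def Jid (p r : ℕ) (t : Fin m → ℕ) (pr : Fin m ⊕ Fin n → Fin m ⊕ Fin n) :
    Submodule F (Module.End F (O F m n)) :=
  Submodule.span F {x | ∃ μ : Mono m n, inA p t μ.1 ∧ Even μ.2.card ∧
    ¬(μ.1 = piF p t ∧ μ.2 = Finset.univ) ∧ ¬(μ.1 = piF p t ∧ μ.2 = ∅) ∧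
    x = DHmono F r pr μ}

/-- The odd part `W₁̄` of the Witt superalgebra `W(m,n;t)`. -/
noncomputable def W1 (p : ℕ) (t : Fin m → ℕ) : Submodule F (Module.End F (O F m n)) :=
  Submodule.span F {x | ∃ (μ : Mono m n) (i : Fin m ⊕ Fin n), inA p t μ.1 ∧
    Odd (μ.2.card + idxPar i) ∧ x = fD F μ i}

/-- The `ℤ`-degree-`k` component of `W(m,n;t)`. -/
noncomputable def Wcomp (p : ℕ) (t : Fin m → ℕ) (k : ℤ) :
    Submodule F (Module.End F (O F m n)) :=
  Submodule.span F {x | ∃ (μ : Mono m n) (i : Fin m ⊕ Fin n), inA p t μ.1 ∧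
    (((∑ l, μ.1 l : ℕ) : ℤ) + (μ.2.card : ℤ)) - 1 = k ∧ x = fD F μ i}

/-- The iterated adjoint action `(ad D)^k (E)`. -/
noncomputable def adIter (D : Module.End F (O F m n)) (k : ℕ)
    (E : Module.End F (O F m n)) : Module.End F (O F m n) :=
  (fun E => D * E - E * D)^[k] E

end HamSup

namespace HamSup

section base
set_option linter.unusedSimpArgs false
variable (F : Type) [Field F] {m n : ℕ}

/-- The span of the monomials satisfying a predicate. -/
noncomputable def Sp (P : Mono m n → Prop) : Submodule F (O F m n) :=
  Submodule.span F {x | ∃ μ : Mono m n, P μ ∧ x = X F μ}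

variable {F}

lemma extend_X {N : Type} [AddCommGroup N] [Module F N] (v : Mono m n → N) (μ : Mono m n) :
    extend F v (X F μ) = v μ := by
  simp [extend, X]

lemma lext {N : Type} [AddCommMonoid N] [Module F N] {S T : O F m n →ₗ[F] N}
    (h : ∀ μ, S (X F μ) = T (X F μ)) : S = T := by
  apply Finsupp.lhom_ext'
  intro μ
  apply LinearMap.ext_ring
  exact h μ

lemma X_mem {P : Mono m n → Prop} {μ : Mono m n} (h : P μ) : X F μ ∈ Sp F P :=
  Submodule.subset_span ⟨μ, h, rfl⟩

lemma Sp_map {N : Type} [AddCommMonoid N] [Module F N] {P : Mono m n → Prop}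
    (T : O F m n →ₗ[F] N) (S : Submodule F N) (h : ∀ μ, P μ → T (X F μ) ∈ S)
    {a : O F m n} (ha : a ∈ Sp F P) : T a ∈ S := by
  have : Sp F P ≤ S.comap T := by
    apply Submodule.span_le.2
    rintro _ ⟨μ, hμ, rfl⟩
    exact h μ hμ
  exact this ha

lemma Sp_eq {N : Type} [AddCommMonoid N] [Module F N] {P : Mono m n → Prop}
    (T T' : O F m n →ₗ[F] N) (h : ∀ μ, P μ → T (X F μ) = T' (X F μ))
    {a : O F m n} (ha : a ∈ Sp F P) : T a = T' a := by
  refine LinearMap.eqOn_span (s := {x | ∃ μ : Mono m n, P μ ∧ x = X F μ}) ?_ ha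
  rintro _ ⟨μ, hμ, rfl⟩
  exact h μ hμ

lemma Sp_mono {P Q : Mono m n → Prop} (h : ∀ μ, P μ → Q μ) : Sp F P ≤ Sp F Q := by
  apply Submodule.span_mono
  rintro _ ⟨μ, hμ, rfl⟩
  exact ⟨μ, h μ hμ, rfl⟩

lemma mem_Sp {P : Mono m n → Prop} {a : O F m n} : a ∈ Sp F P ↔ ∀ μ, a μ ≠ 0 → P μ := by
  constructor
  · intro ha
    have h1 : Sp F P ≤ Finsupp.supported F F {μ | P μ} := by
      apply Submodule.span_le.2
      rintro _ ⟨μ, hμ, rfl⟩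
      exact Finsupp.single_mem_supported F 1 hμ
    intro μ hμ
    have := (Finsupp.mem_supported F a).1 (h1 ha)
    exact this (Finset.mem_coe.2 (Finsupp.mem_support_iff.2 hμ))
  · intro h
    rw [← Finsupp.sum_single a]
    apply Submodule.sum_mem
    intro μ hμ
    have : Finsupp.single μ (a μ) = a μ • X F μ := by simp [X]
    simp only [this]
    exact Submodule.smul_mem _ _ (X_mem (h μ (Finsupp.mem_support_iff.1 hμ)))

lemma mulO_X (μ ν : Mono m n) : mulO F (X F μ) (X F ν) = mulMono F μ ν := by
  simp [mulO, extend_X]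

lemma pdE_X (i : Fin m) (μ : Mono m n) : pdE F i (X F μ) =
    if μ.1 i = 0 then 0 else X F (Function.update μ.1 i (μ.1 i - 1), μ.2) := by
  simp [pdE, extend_X]

lemma pdO_X (j : Fin n) (μ : Mono m n) : pdO F j (X F μ) =
    if j ∈ μ.2 then ((-1 : F) ^ (μ.2.filter fun k => k < j).card) • X F (μ.1, μ.2.erase j)
    else 0 := by
  simp [pdO, extend_X]

lemma inv_sum (u v : Finset (Fin n)) :
    invCount u v = ∑ a ∈ u, ∑ b ∈ v, if b < a then 1 else 0 := by
  rw [invCount, Finset.card_filter, Finset.sum_product]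

lemma inv_union_right {u v w : Finset (Fin n)} (h : Disjoint v w) :
    invCount u (v ∪ w) = invCount u v + invCount u w := by
  simp only [inv_sum, Finset.sum_union h, Finset.sum_add_distrib]

lemma inv_union_left {u v w : Finset (Fin n)} (h : Disjoint u v) :
    invCount (u ∪ v) w = invCount u w + invCount v w := by
  simp only [inv_sum, Finset.sum_union h]

lemma inv_comm {u v : Finset (Fin n)} (h : Disjoint u v) :
    invCount u v + invCount v u = u.card * v.card := by
  rw [inv_sum, inv_sum, Finset.sum_comm (s := v), ← Finset.sum_add_distrib]
  rw [Finset.card_eq_sum_ones u, Finset.sum_mul]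
  apply Finset.sum_congr rfl
  intro a ha
  rw [← Finset.sum_add_distrib, Finset.card_eq_sum_ones v, one_mul]
  apply Finset.sum_congr rfl
  intro b hb
  have : a ≠ b := fun e => (Finset.disjoint_left.1 h ha) (e ▸ hb)
  rcases lt_or_gt_of_ne this with h | h
  · simp [h, h.le.not_gt]
  · simp [h, h.le.not_gt]

lemma card_lt (j : Fin n) (u : Finset (Fin n)) :
    (u.filter fun k => k < j).card = invCount {j} u := by
  rw [inv_sum, Finset.card_filter]; simp

lemma inv_self (j : Fin n) : invCount {j} ({j} : Finset (Fin n)) = 0 := by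
  simp [inv_sum]

lemma inv_erase_right {u v : Finset (Fin n)} {j : Fin n} (h : j ∈ v) :
    invCount u v = invCount u (v.erase j) + invCount u {j} := by
  rw [← inv_union_right (by simp)]
  congr 1
  ext x; by_cases hx : x = j <;> simp [hx, h]

lemma inv_erase_left {u v : Finset (Fin n)} {j : Fin n} (h : j ∈ u) :
    invCount u v = invCount (u.erase j) v + invCount {j} v := by
  rw [← inv_union_left (by simp)]
  congr 1
  ext x; by_cases hx : x = j <;> simp [hx, h]

lemma sgn_eq {a b : ℕ} (h : a % 2 = b % 2) : (-1 : F) ^ a = (-1 : F) ^ b := by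
  rw [neg_one_pow_eq_pow_mod_two, h, ← neg_one_pow_eq_pow_mod_two]

lemma sgn_neg {a b : ℕ} (h : (a + 1) % 2 = b % 2) : (-1 : F) ^ a = - (-1 : F) ^ b := by
  rw [← sgn_eq h, pow_succ]; simp

/-- binomial weight -/
def wt (α β : Fin m → ℕ) : ℕ := ∏ i, (α i + β i).choose (α i)

lemma mulMono_eq (μ ν : Mono m n) : mulMono F μ ν =
    if Disjoint μ.2 ν.2 then
    (((-1 : F) ^ invCount μ.2 ν.2) * (wt μ.1 ν.1 : F)) • X F (μ.1 + ν.1, μ.2 ∪ ν.2)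
  else 0 := by
  simp [mulMono, wt]

lemma wt_comm (α β : Fin m → ℕ) : wt α β = wt β α := by
  apply Finset.prod_congr rfl
  intro i _
  rw [add_comm (β i), Nat.choose_symm_add]

lemma wt_assoc (α β γ : Fin m → ℕ) : wt β γ * wt α (β + γ) = wt α β * wt (α + β) γ := by
  simp only [wt, ← Finset.prod_mul_distrib]
  apply Finset.prod_congr rfl
  intro i _
  simp only [Pi.add_apply]
  have h := Nat.choose_mul (n := α i + β i + γ i) (k := α i + β i) (s := α i) (by omega)
  rw [show α i + β i + γ i - α i = β i + γ i by omega, show α i + β i - α i = β i by omega] at h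
  rw [← add_assoc]
  linarith

lemma mul_assocX (μ ν ρ : Mono m n) :
    mulO F (X F μ) (mulO F (X F ν) (X F ρ)) = mulO F (mulO F (X F μ) (X F ν)) (X F ρ) := by
  simp only [mulO_X, mulMono_eq]
  by_cases h1 : Disjoint μ.2 ν.2 <;> by_cases h2 : Disjoint ν.2 ρ.2 <;>
    by_cases h3 : Disjoint μ.2 ρ.2 <;>
    simp only [h1, h2, if_true, if_false, map_smul, map_zero, LinearMap.smul_apply, mulO_X,
      mulMono_eq, Finset.disjoint_union_right, Finset.disjoint_union_left, h3, and_true, and_false,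
      true_and, false_and, smul_zero, LinearMap.zero_apply]
  rw [smul_smul, smul_smul, add_assoc, Finset.union_assoc, inv_union_right h2, inv_union_left h1]
  congr 1
  have := congrArg (Nat.cast (R := F)) (wt_assoc μ.1 ν.1 ρ.1)
  push_cast at this
  rw [pow_add, pow_add]
  linear_combination ((-1) ^ invCount ν.2 ρ.2 * ((-1) ^ invCount μ.2 ν.2 * (-1) ^ invCount μ.2 ρ.2)) * this

lemma L_mul (a b : O F m n) :
    (mulO F (mulO F a b) : Module.End F (O F m n)) = (mulO F a : Module.End F (O F m n)) * mulO F b := by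
  have h : (mulO F (m := m) (n := n)).compr₂ (mulO F) =
      ((LinearMap.mul F (Module.End F (O F m n))).compl₁₂ (mulO F) (mulO F)) := by
    apply lext; intro μ; apply lext; intro ν; apply lext; intro ρ
    exact (mul_assocX μ ν ρ).symm
  exact congrArg (fun T => T a b) h

lemma mul_commX (μ ν : Mono m n) :
    mulO F (X F μ) (X F ν) = (-1 : F) ^ (μ.2.card * ν.2.card) • mulO F (X F ν) (X F μ) := by
  simp only [mulO_X, mulMono_eq, disjoint_comm (a := ν.2)]
  split_ifs with h
  · rw [smul_smul, add_comm ν.1, Finset.union_comm ν.2, wt_comm ν.1, ← mul_assoc, ← pow_add]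
    congr 2
    apply sgn_eq
    have := inv_comm h
    omega
  · simp

/-- Parity spaces -/
noncomputable abbrev Par (F : Type) [Field F] {m n : ℕ} (e : ℕ) : Submodule F (O F m n) :=
  Sp F (fun μ => μ.2.card % 2 = e % 2)

lemma mul_comm_par {e d : ℕ} {a b : O F m n} (ha : a ∈ Par F e) (hb : b ∈ Par F d) :
    mulO F a b = (-1 : F) ^ (e * d) • mulO F b a := by
  refine Sp_eq ((mulO F).flip b) ((-1 : F) ^ (e * d) • mulO F b) (fun μ hμ => ?_) ha
  refine Sp_eq (mulO F (X F μ)) ((-1 : F) ^ (e * d) • (mulO F).flip (X F μ)) (fun ν hν => ?_) hb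
  rw [mul_commX]
  simp only [LinearMap.smul_apply, LinearMap.flip_apply]
  rw [sgn_eq]
  rw [Nat.mul_mod, hμ, hν, ← Nat.mul_mod]

lemma LL_comm {e d : ℕ} {a b : O F m n} (ha : a ∈ Par F e) (hb : b ∈ Par F d) :
    (mulO F a : Module.End F (O F m n)) * mulO F b = (-1 : F) ^ (e * d) • ((mulO F b : Module.End F (O F m n)) * mulO F a) := by
  rw [← L_mul, ← L_mul, mul_comm_par ha hb, map_smul]

lemma wt_split (i : Fin m) (α β : Fin m → ℕ) :
    wt α β = (α i + β i).choose (α i) * ∏ l ∈ {i}ᶜ, (α l + β l).choose (α l) := by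
  rw [wt, Fintype.prod_eq_mul_prod_compl i]

lemma wt_upd_left (i : Fin m) (α β : Fin m → ℕ) (c : ℕ) :
    wt (Function.update α i c) β = (c + β i).choose c * ∏ l ∈ {i}ᶜ, (α l + β l).choose (α l) := by
  rw [wt_split i]
  simp only [Function.update_self]
  congr 1
  apply Finset.prod_congr rfl
  intro l hl
  have : l ≠ i := by simpa using hl
  simp [this]

lemma wt_upd_right (i : Fin m) (α β : Fin m → ℕ) (c : ℕ) :
    wt α (Function.update β i c) = (α i + c).choose (α i) * ∏ l ∈ {i}ᶜ, (α l + β l).choose (α l) := by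
  rw [wt_split i]
  simp only [Function.update_self]
  congr 1
  apply Finset.prod_congr rfl
  intro l hl
  have : l ≠ i := by simpa using hl
  simp [this]

lemma pdE_mulX (i : Fin m) (μ ν : Mono m n) :
    pdE F i (mulO F (X F μ) (X F ν)) =
      mulO F (pdE F i (X F μ)) (X F ν) + mulO F (X F μ) (pdE F i (X F ν)) := by
  obtain ⟨α, u⟩ := μ
  obtain ⟨β, v⟩ := ν
  have e1 : Function.update α i (α i - 1) + β = Function.update (α + β) i (α i - 1 + β i) := by
    ext l; by_cases hl : l = i
    · subst hl; simp
    · simp [hl]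
  have e2 : α + Function.update β i (β i - 1) = Function.update (α + β) i (α i + (β i - 1)) := by
    ext l; by_cases hl : l = i
    · subst hl; simp
    · simp [hl]
  by_cases h : Disjoint u v
  · have k1 : mulO F (X F (Function.update α i (α i - 1), u)) (X F (β, v)) =
      ((-1 : F) ^ invCount u v * (wt (Function.update α i (α i - 1)) β : F)) •
        X F (Function.update (α + β) i (α i - 1 + β i), u ∪ v) := by
      rw [mulO_X, mulMono_eq]; simp [h, e1]
    have k2 : mulO F (X F (α, u)) (X F (Function.update β i (β i - 1), v)) =
      ((-1 : F) ^ invCount u v * (wt α (Function.update β i (β i - 1)) : F)) •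
        X F (Function.update (α + β) i (α i + (β i - 1)), u ∪ v) := by
      rw [mulO_X, mulMono_eq]; simp [h, e2]
    have k0 : mulO F (X F (α, u)) (X F (β, v)) =
      ((-1 : F) ^ invCount u v * (wt α β : F)) • X F (α + β, u ∪ v) := by
      rw [mulO_X, mulMono_eq]; simp [h]
    rw [k0, map_smul, pdE_X, pdE_X, pdE_X]
    by_cases ha : α i = 0 <;> by_cases hb : β i = 0
    · simp [ha, hb]
    · simp only [ha, hb, Pi.add_apply, if_true, if_false, map_zero, LinearMap.zero_apply, zero_add,
        k2, wt_upd_right]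
      rw [wt_split i]
      simp [ha]
    · simp only [ha, hb, Pi.add_apply, if_true, if_false, map_zero, add_zero, Nat.add_eq_zero_iff, and_true,
        k1, wt_upd_left]
      rw [wt_split i]
      simp [hb]
    · simp only [ha, hb, Pi.add_apply, if_false, Nat.add_eq_zero_iff, and_false, 
        k1, k2, wt_upd_left, wt_upd_right]
      rw [wt_split i, show α i + (β i - 1) = α i + β i - 1 by omega,
        show α i - 1 + β i = α i + β i - 1 by omega, ← add_smul]
      congr 1
      obtain ⟨a, ha'⟩ := Nat.exists_eq_succ_of_ne_zero ha
      rw [ha', show a.succ + β i = (a + β i) + 1 by omega, Nat.succ_eq_add_one, Nat.choose_succ_succ]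
      simp only [Nat.add_sub_cancel]
      push_cast
      ring
  · rw [mulO_X, mulMono_eq, if_neg h, pdE_X, pdE_X]
    split_ifs <;> simp [mulO_X, mulMono_eq, h]

lemma pdO_mulX (j : Fin n) (μ ν : Mono m n) :
    pdO F j (mulO F (X F μ) (X F ν)) =
      mulO F (pdO F j (X F μ)) (X F ν) +
        (-1 : F) ^ μ.2.card • mulO F (X F μ) (pdO F j (X F ν)) := by
  obtain ⟨α, u⟩ := μ
  obtain ⟨β, v⟩ := ν
  simp only [pdO_X, mulO_X, mulMono_eq, card_lt]
  by_cases hu : j ∈ u <;> by_cases hv : j ∈ v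
  · have hd : ¬ Disjoint u v := fun h => Finset.disjoint_left.1 h hu hv
    have i1 := inv_erase_right (u := u.erase j) hv
    have i2 := inv_erase_left (v := v.erase j) hu
    have i3 := inv_comm (u := u.erase j) (v := {j}) (by simp)
    have i4 := inv_erase_right (u := {j}) hu
    have i5 := inv_erase_right (u := {j}) hv
    have i6 := Finset.card_erase_add_one hu
    rw [inv_self] at i4 i5
    rw [Finset.card_singleton, mul_one] at i3
    have hiff : Disjoint (u.erase j) v ↔ Disjoint u (v.erase j) := by
      simp only [Finset.disjoint_left, Finset.mem_erase]
      constructor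
      · intro h a h1 h2; exact h ⟨h2.1, h1⟩ h2.2
      · intro h a h1 h2; exact h h1.2 ⟨h1.1, h2⟩
    have hun : u.erase j ∪ v = u ∪ v.erase j := by
      ext x; by_cases hx : x = j <;> simp [hx, hu, hv]
    simp only [hu, hv, hd, if_true, if_false, map_zero, map_smul, LinearMap.smul_apply, mulO_X, mulMono_eq, hiff, hun]
    split_ifs with h
    · rw [smul_smul, smul_smul, smul_smul, ← add_smul, ← mul_assoc, ← mul_assoc, ← pow_add, ← pow_add, ← pow_add]
      rw [sgn_neg (b := u.card + invCount {j} v + invCount u (v.erase j)) (by omega)]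
      rw [neg_mul, neg_add_cancel, zero_smul]
    · simp
  · by_cases h : Disjoint u v
    · have h' : Disjoint (u.erase j) v := Finset.disjoint_of_subset_left (Finset.erase_subset _ _) h
      simp only [hu, hv, h, h', if_true, if_false, map_zero, map_smul, LinearMap.smul_apply, mulO_X, mulMono_eq,
        smul_zero, add_zero, pdO_X, card_lt, Finset.mem_union, true_or]
      rw [smul_smul, smul_smul, Finset.erase_union_distrib, Finset.erase_eq_of_notMem hv, mul_right_comm, ← pow_add, ← mul_assoc, ← pow_add]
      congr 2
      apply sgn_eq
      rw [inv_union_right h, inv_erase_left (v := v) hu]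
      omega
    · have h' : ¬ Disjoint (u.erase j) v := by
        intro h2; apply h
        rw [Finset.disjoint_left] at h2 ⊢
        intro a ha hb
        exact h2 (Finset.mem_erase.2 ⟨fun e => hv (e ▸ hb), ha⟩) hb
      simp [hu, hv, h, h', mulO_X, mulMono_eq]
  · by_cases h : Disjoint u v
    · have h' : Disjoint u (v.erase j) := Finset.disjoint_of_subset_right (Finset.erase_subset _ _) h
      simp only [hu, hv, h, h', if_true, if_false, map_zero, map_smul, LinearMap.smul_apply, mulO_X, mulMono_eq,
        LinearMap.zero_apply, zero_add, pdO_X, card_lt, Finset.mem_union, or_true]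
      rw [smul_smul, smul_smul, smul_smul, Finset.erase_union_distrib, Finset.erase_eq_of_notMem hu, mul_right_comm, ← pow_add, ← mul_assoc, ← pow_add, ← pow_add]
      congr 2
      apply sgn_eq
      have i3 := inv_comm (u := u) (v := {j}) (by simpa using hu)
      rw [Finset.card_singleton, mul_one] at i3
      rw [inv_union_right h, inv_erase_right (u := u) hv]
      omega
    · have h' : ¬ Disjoint u (v.erase j) := by
        intro h2; apply h
        rw [Finset.disjoint_left] at h2 ⊢
        intro a ha hb
        exact h2 ha (Finset.mem_erase.2 ⟨fun e => hu (e ▸ ha), hb⟩)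
      simp [hu, hv, h, h', mulO_X, mulMono_eq]
  · by_cases h : Disjoint u v <;> simp [hu, hv, h, pdO_X]

lemma pd_mulX (k : Fin m ⊕ Fin n) (μ ν : Mono m n) :
    pd F k (mulO F (X F μ) (X F ν)) =
      mulO F (pd F k (X F μ)) (X F ν) +
        (-1 : F) ^ (idxPar k * μ.2.card) • mulO F (X F μ) (pd F k (X F ν)) := by
  rcases k with i | j
  · simpa [pd, idxPar] using pdE_mulX i μ ν
  · simpa [pd, idxPar] using pdO_mulX j μ ν

lemma pd_L (k : Fin m ⊕ Fin n) {e : ℕ} {a : O F m n} (ha : a ∈ Par F e) :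
    (pd F k : Module.End F (O F m n)) * mulO F a =
      mulO F (pd F k a) + (-1 : F) ^ (idxPar k * e) • ((mulO F a : Module.End F (O F m n)) * pd F k) := by
  refine Sp_eq ((LinearMap.mulLeft F (pd F k : Module.End F (O F m n))).comp (mulO F))
    ((mulO F).comp (pd F k) + (-1 : F) ^ (idxPar k * e) •
      ((LinearMap.mulRight F (pd F k : Module.End F (O F m n))).comp (mulO F))) (fun μ hμ => ?_) ha
  apply lext
  intro ν
  refine (pd_mulX k μ ν).trans ?_
  rw [sgn_eq (b := idxPar k * e) (by rw [Nat.mul_mod, hμ, ← Nat.mul_mod])]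
  rfl

lemma pd_par (k : Fin m ⊕ Fin n) {e : ℕ} {a : O F m n} (ha : a ∈ Par F e) :
    pd F k a ∈ Par F (e + idxPar k) := by
  refine Sp_map (pd F k) _ (fun μ hμ => ?_) ha
  rcases k with i | j
  · simp only [pd, Sum.elim_inl, pdE_X]
    split_ifs
    · simp
    · exact X_mem (by simpa [idxPar] using hμ)
  · simp only [pd, Sum.elim_inr, pdO_X]
    split_ifs with h
    · apply Submodule.smul_mem
      apply X_mem
      have := Finset.card_erase_add_one h
      simp only [idxPar, Sum.elim_inr]
      omega
    · simp

lemma pd_comm (k l : Fin m ⊕ Fin n) :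
    (pd F k : Module.End F (O F m n)) * pd F l =
      (-1 : F) ^ (idxPar k * idxPar l) • ((pd F l : Module.End F (O F m n)) * pd F k) := by
  apply lext
  intro μ
  simp only [Module.End.mul_apply, LinearMap.smul_apply]
  rcases k with i | j <;> rcases l with i' | j'
  · simp only [pd, idxPar, Sum.elim_inl, mul_zero, pow_zero, one_smul, pdE_X]
    by_cases hi : i = i'
    · rw [hi]
    · by_cases h1 : μ.1 i = 0 <;> by_cases h2 : μ.1 i' = 0 <;>
        simp [h1, h2, pdE_X, hi, Ne.symm hi, Function.update_of_ne]
      rw [Function.update_comm hi]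
  · simp only [pd, idxPar, Sum.elim_inl, Sum.elim_inr, zero_mul, pow_zero, one_smul, pdE_X, pdO_X]
    by_cases h1 : μ.1 i = 0 <;> by_cases h2 : j' ∈ μ.2 <;> simp [h1, h2, pdE_X, pdO_X]
  · simp only [pd, idxPar, Sum.elim_inl, Sum.elim_inr, mul_zero, pow_zero, one_smul, pdE_X, pdO_X]
    by_cases h1 : μ.1 i' = 0 <;> by_cases h2 : j ∈ μ.2 <;> simp [h1, h2, pdE_X, pdO_X]
  · simp only [pd, idxPar, Sum.elim_inr, mul_one, pow_one, neg_smul, one_smul, pdO_X]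
    by_cases hj : j = j'
    · subst hj; by_cases h : j ∈ μ.2 <;> simp [h, pdO_X]
    · by_cases h1 : j ∈ μ.2 <;> by_cases h2 : j' ∈ μ.2 <;>
        simp only [h1, h2, if_true, if_false, map_smul, map_zero, pdO_X, Finset.mem_erase, ne_eq, hj, Ne.symm hj,
          not_false_eq_true, and_true, and_false, smul_zero, neg_zero]
      rw [smul_smul, smul_smul, Finset.erase_right_comm, ← neg_smul, ← pow_add, ← pow_add]
      congr 1
      apply sgn_neg
      simp only [card_lt]
      have i1 := inv_erase_right (u := {j}) h2
      have i2 := inv_erase_right (u := {j'}) h1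
      have i3 := inv_comm (u := {j}) (v := {j'}) (by simpa using hj)
      simp only [Finset.card_singleton, mul_one] at i3
      omega

end base
end HamSup

namespace HamSup

section bracket
set_option linter.unusedSimpArgs false
variable {F : Type} [Field F] {m n : ℕ}

/-- Hamiltonian operator with sign parameter `c`. -/
noncomputable def DC (F : Type) [Field F] {m n : ℕ} (r : ℕ) (pr : Fin m ⊕ Fin n → Fin m ⊕ Fin n)
    (c : F) : O F m n →ₗ[F] Module.End F (O F m n) :=
  ∑ i : Fin m ⊕ Fin n, (((tau r i : ℤ) : F) * c ^ idxPar i) •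
    ((LinearMap.mulRight F (pd F (pr i) : Module.End F (O F m n))).comp ((mulO F).comp (pd F i)))

variable {r : ℕ} {pr : Fin m ⊕ Fin n → Fin m ⊕ Fin n}

lemma DC_apply (c : F) (f : O F m n) : DC F r pr c f =
    ∑ i : Fin m ⊕ Fin n, (((tau r i : ℤ) : F) * c ^ idxPar i) •
      ((mulO F (pd F i f) : Module.End F (O F m n)) * pd F (pr i)) := by
  simp only [DC, LinearMap.sum_apply, LinearMap.smul_apply]
  rfl

lemma DC1_apply (f : O F m n) : DC F r pr 1 f =
    ∑ i : Fin m ⊕ Fin n, ((tau r i : ℤ) : F) •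
      ((mulO F (pd F i f) : Module.End F (O F m n)) * pd F (pr i)) := by
  simp [DC_apply]

lemma DC1_apply2 (f g : O F m n) : DC F r pr 1 f g =
    ∑ i : Fin m ⊕ Fin n, ((tau r i : ℤ) : F) • mulO F (pd F i f) (pd F (pr i) g) := by
  simp [DC1_apply, LinearMap.sum_apply]

lemma DHmono_eq (μ : Mono m n) : DHmono F r pr μ = DC F r pr ((-1) ^ μ.2.card) (X F μ) := by
  rw [DC_apply, DHmono]
  apply Finset.sum_congr rfl
  intro i _
  rw [← pow_mul, mul_comm μ.2.card]
  rfl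

lemma DHmono_even {μ : Mono m n} (h : Even μ.2.card) : DHmono F r pr μ = DC F r pr 1 (X F μ) := by
  rw [DHmono_eq, h.neg_one_pow]

lemma sq1 (a : ℕ) : ((-1 : F) ^ a) * (-1) ^ a = 1 := by
  rw [← pow_add]; exact Even.neg_one_pow ⟨a, rfl⟩

lemma pd_pd (k l : Fin m ⊕ Fin n) (f : O F m n) :
    pd F k (pd F l f) = (-1 : F) ^ (idxPar k * idxPar l) • pd F l (pd F k f) :=
  congrArg (fun T => T f) (pd_comm (F := F) k l)

lemma stepA (hpar : ∀ i, idxPar (pr i) = idxPar i) {f : O F m n} (hf : f ∈ Par F 0)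
    (k : Fin m ⊕ Fin n) :
    (pd F k : Module.End F (O F m n)) * DC F r pr 1 f = DC F r pr 1 f * pd F k +
      ∑ i, ((tau r i : ℤ) : F) •
        ((mulO F (pd F k (pd F i f)) : Module.End F (O F m n)) * pd F (pr i)) := by
  rw [DC1_apply, Finset.mul_sum, Finset.sum_mul, ← Finset.sum_add_distrib]
  apply Finset.sum_congr rfl
  intro i _
  rw [mul_smul_comm, ← mul_assoc, pd_L k (pd_par i hf), add_mul, smul_mul_assoc, smul_mul_assoc,
    mul_assoc _ (pd F k), pd_comm k (pr i), hpar, mul_smul_comm, smul_smul, zero_add, sq1, one_smul,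
    ← smul_add, mul_assoc, add_comm]

lemma stepB (hpar : ∀ i, idxPar (pr i) = idxPar i) {f a : O F m n} (hf : f ∈ Par F 0) {e : ℕ}
    (ha : a ∈ Par F e) :
    DC F r pr 1 f * (mulO F a : Module.End F (O F m n)) =
      mulO F (DC F r pr 1 f a) + (mulO F a : Module.End F (O F m n)) * DC F r pr 1 f := by
  rw [DC1_apply2, map_sum, DC1_apply, Finset.mul_sum, Finset.sum_mul, ← Finset.sum_add_distrib]
  apply Finset.sum_congr rfl
  intro i _
  rw [map_smul, L_mul, smul_mul_assoc, mul_assoc, pd_L (pr i) ha, hpar, mul_add, mul_smul_comm,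
    ← mul_assoc _ _ (pd F (pr i)), LL_comm (pd_par i hf) ha, smul_mul_assoc, smul_smul, zero_add,
    sq1, one_smul, smul_add, mul_smul_comm, mul_assoc]

lemma abs_bracket {R I : Type} [Ring R] [Algebra F R] [Fintype I] (D : R) (P A A' : I → R)
    (T C : I → F) (B : I → I → R) (pr : I → I) (hinv : Function.Involutive pr)
    (hA : ∀ k, P k * D = D * P k + ∑ i, T i • (B k i * P (pr i)))
    (hB : ∀ k, D * A k = A' k + A k * D)
    (hs : ∀ k i, (T k * C k * T i) • (B k i * A (pr i)) =
      (-(T (pr i) * C (pr i) * T k)) • (A (pr i) * B i k)) :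
    D * (∑ k, (T k * C k) • (A k * P (pr k))) - (∑ k, (T k * C k) • (A k * P (pr k))) * D =
      ∑ k, (T k * C k) • ((A' k + ∑ i, T i • (B k i * A (pr i))) * P (pr k)) := by
  have e1 : ∀ k, D * (A k * P (pr k)) - (A k * P (pr k)) * D =
      A' k * P (pr k) - ∑ i, T i • (A k * (B (pr k) i * P (pr i))) := by
    intro k
    have : A k * ∑ i, T i • (B (pr k) i * P (pr i)) =
      ∑ i, T i • (A k * (B (pr k) i * P (pr i))) := by
      rw [Finset.mul_sum]; simp only [mul_smul_comm]
    rw [← this, mul_assoc (A k), hA, ← mul_assoc, hB]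
    noncomm_ring
  have e2 : D * (∑ k, (T k * C k) • (A k * P (pr k))) - (∑ k, (T k * C k) • (A k * P (pr k))) * D =
      ∑ k, (T k * C k) • (A' k * P (pr k)) -
      ∑ k, ∑ i, (T k * C k * T i) • (A k * (B (pr k) i * P (pr i))) := by
    rw [Finset.mul_sum, Finset.sum_mul, ← Finset.sum_sub_distrib, ← Finset.sum_sub_distrib]
    apply Finset.sum_congr rfl
    intro k _
    rw [mul_smul_comm, smul_mul_assoc, ← smul_sub, e1, smul_sub, Finset.smul_sum]
    simp only [smul_smul]
  rw [e2, ← Equiv.sum_comp hinv.toPerm (fun k => ∑ i, (T k * C k * T i) • (A k * (B (pr k) i * P (pr i)))),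
    Finset.sum_comm, sub_eq_add_neg, ← Finset.sum_neg_distrib, ← Finset.sum_add_distrib]
  apply Finset.sum_congr rfl
  intro k _
  rw [add_mul, smul_add, Finset.sum_mul, Finset.smul_sum, ← Finset.sum_neg_distrib]
  congr 1
  apply Finset.sum_congr rfl
  intro i _
  simp only [Function.Involutive.coe_toPerm, hinv i]
  rw [← mul_assoc, ← smul_mul_assoc, ← neg_mul, ← neg_smul, ← hs, smul_mul_assoc, smul_mul_assoc, smul_smul]

lemma main_bracket (hpar : ∀ i, idxPar (pr i) = idxPar i) (hinv : Function.Involutive pr)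
    (htau : ∀ i, ((tau r (pr i) : ℤ) : F) = - ((-1) ^ idxPar i * ((tau r i : ℤ) : F)))
    {f g : O F m n} (hf : f ∈ Par F 0) {e : ℕ} (hg : g ∈ Par F e) :
    DC F r pr 1 f * DC F r pr ((-1) ^ e) g - DC F r pr ((-1) ^ e) g * DC F r pr 1 f =
      DC F r pr ((-1) ^ e) (DC F r pr 1 f g) := by
  have key := abs_bracket (F := F) (R := Module.End F (O F m n)) (DC F r pr 1 f) (fun k => pd F k)
    (fun k => mulO F (pd F k g)) (fun k => mulO F (DC F r pr 1 f (pd F k g)))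
    (fun k => ((tau r k : ℤ) : F)) (fun k => ((-1) ^ e) ^ idxPar k)
    (fun k i => mulO F (pd F k (pd F i f))) pr hinv (fun k => stepA hpar hf k)
    (fun k => stepB hpar hf (pd_par k hg)) (fun k i => by
      have h1 := LL_comm (pd_par k (pd_par i hf)) (pd_par (pr i) hg)
      rw [h1, pd_pd k i f, map_smul, mul_smul_comm, smul_smul, smul_smul, htau, hpar]
      congr 1
      have h3 : (-1 : F) ^ ((0 + idxPar i + idxPar k) * (e + idxPar i)) * (-1) ^ (idxPar k * idxPar i)
          * ((-1) ^ e) ^ idxPar k = (-1) ^ idxPar i * ((-1) ^ e) ^ idxPar i := by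
        have hi : idxPar i = 0 ∨ idxPar i = 1 := by rcases i with i | i <;> simp [idxPar]
        have hk : idxPar k = 0 ∨ idxPar k = 1 := by rcases k with i | i <;> simp [idxPar]
        rw [← pow_mul, ← pow_mul, ← pow_add, ← pow_add, ← pow_add]
        apply sgn_eq
        rcases hi with hi | hi <;> rcases hk with hk | hk <;> rw [hi, hk] <;> ring_nf <;> omega
      linear_combination (((tau r k : ℤ) : F) * ((tau r i : ℤ) : F)) * h3)
  rw [DC_apply ((-1) ^ e) g, DC_apply ((-1) ^ e) (DC F r pr 1 f g)]
  refine key.trans ?_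
  apply Finset.sum_congr rfl
  intro k _
  have h4 := congrArg (fun T => mulO F (T g)) (stepA (r := r) hpar hf k)
  simp only [Module.End.mul_apply, LinearMap.add_apply, LinearMap.sum_apply, LinearMap.smul_apply,
    map_add, map_sum, map_smul, L_mul] at h4
  rw [h4]

lemma antisymm (hpar : ∀ i, idxPar (pr i) = idxPar i) (hinv : Function.Involutive pr)
    (htau : ∀ i, ((tau r (pr i) : ℤ) : F) = - ((-1) ^ idxPar i * ((tau r i : ℤ) : F)))
    {f g : O F m n} (hf : f ∈ Par F 0) (hg : g ∈ Par F 0) :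
    DC F r pr 1 f g = - DC F r pr 1 g f := by
  rw [DC1_apply2, DC1_apply2, ← Equiv.sum_comp hinv.toPerm, ← Finset.sum_neg_distrib]
  apply Finset.sum_congr rfl
  intro i _
  simp only [Function.Involutive.coe_toPerm, hinv i]
  rw [mul_comm_par (pd_par (pr i) hf) (pd_par i hg), smul_smul, htau, ← neg_smul, hpar]
  congr 1
  have : (-1 : F) ^ ((0 + idxPar i) * (0 + idxPar i)) * (-1) ^ (idxPar i) = 1 := by
    rw [← pow_add]
    have hi : idxPar i = 0 ∨ idxPar i = 1 := by rcases i with i | i <;> simp [idxPar]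
    rcases hi with hi | hi <;> simp [hi]
  linear_combination (-((tau r i : ℤ) : F)) * this

/-- The top odd monomial. -/
noncomputable abbrev om (F : Type) [Field F] (m n : ℕ) : O F m n :=
  X F ((0 : Fin m → ℕ), (Finset.univ : Finset (Fin n)))

lemma odd_mul_om {e : ℕ} (he : e % 2 = 1) {a : O F m n} (ha : a ∈ Par F e) :
    mulO F a (om F m n) = 0 := by
  refine Sp_eq ((mulO F).flip (om F m n)) 0 (fun μ hμ => ?_) ha
  simp only [LinearMap.flip_apply, LinearMap.zero_apply, mulO_X, mulMono_eq]
  rw [if_neg]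
  intro h
  have : μ.2 = ∅ := by
    rw [Finset.eq_empty_iff_forall_notMem]
    intro x hx
    exact Finset.disjoint_left.1 h hx (Finset.mem_univ x)
  rw [this] at hμ
  simp at hμ
  omega

lemma D_om (h2 : (2 : F) ≠ 0) (hinv : Function.Involutive pr) (hpar : ∀ i, idxPar (pr i) = idxPar i)
    (htau1 : ∀ i : Fin m ⊕ Fin n, idxPar i = 1 → tau r i = 1)
    {f : O F m n} (hf : f ∈ Par F 0) : DC F r pr 1 f (om F m n) = 0 := by
  have h1 : DC F r pr 1 f (om F m n) =
      ∑ i : Fin m ⊕ Fin n, (idxPar i : F) • mulO F (pd F (pr i) (pd F i f)) (om F m n) := by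
    rw [DC1_apply2]
    apply Finset.sum_congr rfl
    intro i _
    have hi : idxPar i = 0 ∨ idxPar i = 1 := by rcases i with i | i <;> simp [idxPar]
    rcases hi with hi | hi
    · have : pd F (pr i) (om F m n) = 0 := by
        have := hpar i
        rw [hi] at this
        rcases h : pr i with j | j
        · simp [pd, pdE_X]
        · rw [h] at this; simp [idxPar] at this
      simp [this, hi]
    · have hL := congrArg (fun T => T (om F m n)) (pd_L (pr i) (pd_par i hf))
      simp only [Module.End.mul_apply, LinearMap.add_apply, LinearMap.smul_apply] at hL
      rw [odd_mul_om (by omega) (pd_par i hf), map_zero, hpar, hi] at hL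
      simp only [zero_add, mul_one, pow_one, neg_smul, one_smul] at hL
      rw [htau1 i hi, hi]
      simp only [Int.cast_one, Nat.cast_one, one_smul]
      exact (sub_eq_zero.1 ((sub_eq_add_neg _ _).trans hL.symm)).symm
  have h3 : DC F r pr 1 f (om F m n) = - DC F r pr 1 f (om F m n) := by
    conv_lhs => rw [h1, ← Equiv.sum_comp hinv.toPerm]
    rw [h1, ← Finset.sum_neg_distrib]
    apply Finset.sum_congr rfl
    intro i _
    simp only [Function.Involutive.coe_toPerm, hinv i]
    rw [pd_pd, hpar, map_smul, LinearMap.smul_apply, smul_smul, ← neg_smul]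
    congr 1
    have hi : idxPar i = 0 ∨ idxPar i = 1 := by rcases i with i | i <;> simp [idxPar]
    rcases hi with hi | hi <;> simp [hi]
  have h4 : (2 : F) • DC F r pr 1 f (om F m n) = 0 := by
    rw [two_smul]
    nth_rewrite 2 [h3]
    exact add_neg_cancel _
  exact (smul_eq_zero.1 h4).resolve_left h2

/-- Powers of the even derivative. -/
lemma pdE_L (i : Fin m) (a : O F m n) :
    (pdE F i : Module.End F (O F m n)) * mulO F a = mulO F (pdE F i a) +
      (mulO F a : Module.End F (O F m n)) * pdE F i := by
  have h : ((LinearMap.mulLeft F (pdE F i : Module.End F (O F m n))).comp (mulO F)) =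
    ((mulO F).comp (pdE F i) + 
      ((LinearMap.mulRight F (pdE F i : Module.End F (O F m n))).comp (mulO F))) := by
    apply lext; intro μ; apply lext; intro ν
    exact pdE_mulX i μ ν
  exact congrArg (fun T => T a) h

lemma abs_pow {R V : Type} [Ring R] [Nontrivial R] [Algebra F R] (p : ℕ) (hp : p.Prime) [CharP F p]
    (q : ℕ) (A : R) (G : V → R) (T : V → V) (h : ∀ a, A * G a = G (T a) + G a * A) (a : V) :
    A ^ p ^ q * G a = G (T^[p ^ q] a) + G a * A ^ p ^ q := by
  have : Fact p.Prime := ⟨hp⟩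
  have : CharP (Module.End F R) p := charP_of_injective_algebraMap' F p
  let l : Module.End F R := LinearMap.mulLeft F A
  let r : Module.End F R := LinearMap.mulRight F A
  have h1 : ∀ N : ℕ, ∀ a, ((l - r) ^ N) (G a) = G (T^[N] a) := by
    intro N
    induction N with
    | zero => intro a; simp
    | succ N ih =>
      intro a
      rw [pow_succ, Module.End.mul_apply, Function.iterate_succ_apply, ← ih]
      congr 1
      exact sub_eq_of_eq_add (h a)
  have h2 := h1 (p ^ q) a
  have h3 : (l - r) ^ p ^ q = l ^ p ^ q - r ^ p ^ q :=
    sub_pow_char_pow_of_commute p q (LinearMap.commute_mulLeft_right A A)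
  rw [h3, LinearMap.pow_mulLeft, LinearMap.pow_mulRight] at h2
  rw [← h2]
  exact (sub_add_cancel _ _).symm

lemma Delta_L (p : ℕ) (hp : p.Prime) [CharP F p] (q : ℕ) (i : Fin m) (a : O F m n) :
    (pdE F i : Module.End F (O F m n)) ^ p ^ q * mulO F a =
      mulO F (((pdE F i : Module.End F (O F m n)) ^ p ^ q) a) +
      (mulO F a : Module.End F (O F m n)) * (pdE F i : Module.End F (O F m n)) ^ p ^ q := by
  rw [Module.End.pow_apply]
  exact abs_pow (F := F) (R := Module.End F (O F m n)) p hp q (pdE F i) (fun a => mulO F a)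
    (fun a => pdE F i a) (fun a => pdE_L i a) a

lemma Delta_pd (N : ℕ) (i : Fin m) (k : Fin m ⊕ Fin n) (f : O F m n) :
    ((pdE F i : Module.End F (O F m n)) ^ N) (pd F k f) =
      pd F k (((pdE F i : Module.End F (O F m n)) ^ N) f) := by
  have h : Commute (pdE F i : Module.End F (O F m n)) (pd F k) := by
    have := pd_comm (F := F) (m := m) (n := n) (Sum.inl i) k
    simp only [idxPar, Sum.elim_inl, zero_mul, pow_zero, one_smul] at this
    exact this
  exact congrArg (fun T => T f) (h.pow_left N)

lemma Delta_D (p : ℕ) (hp : p.Prime) [CharP F p] (q : ℕ) (i : Fin m) (f g : O F m n) :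
    ((pdE F i : Module.End F (O F m n)) ^ p ^ q) (DC F r pr 1 f g) =
      DC F r pr 1 (((pdE F i : Module.End F (O F m n)) ^ p ^ q) f) g +
      DC F r pr 1 f (((pdE F i : Module.End F (O F m n)) ^ p ^ q) g) := by
  simp only [DC1_apply2, map_sum, map_smul]
  rw [← Finset.sum_add_distrib]
  apply Finset.sum_congr rfl
  intro k _
  rw [← smul_add]
  congr 1
  have := congrArg (fun T => T (pd F (pr k) g)) (Delta_L p hp q i (pd F k f))
  rw [← Delta_pd, ← Delta_pd]
  exact this

end bracket
end HamSup

namespace HamSup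

section final
set_option linter.unusedSimpArgs false
variable {F : Type} [Field F] {m n : ℕ}

/-- degree of a monomial -/
def dg (μ : Mono m n) : ℕ := (∑ l, μ.1 l) + μ.2.card

/-- coordinate functions -/
noncomputable def xx (F : Type) [Field F] {m n : ℕ} : Fin m ⊕ Fin n → O F m n :=
  Sum.elim (fun i => X F (Pi.single i 1, ∅)) (fun j => X F (0, {j}))

lemma pd_xx (k l : Fin m ⊕ Fin n) :
    pd F k (xx F l) = if k = l then X F ((0 : Fin m → ℕ), (∅ : Finset (Fin n))) else 0 := by
  rcases k with i | j <;> rcases l with i' | j'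
  · by_cases h : i = i'
    · subst h
      have e : Function.update (Pi.single i 1 : Fin m → ℕ) i 0 = 0 := by
        ext l
        by_cases hl : l = i
        · subst hl; simp
        · simp [hl]
      simp [pd, xx, pdE_X, e]
    · simp [pd, xx, pdE_X, h]
  · simp [pd, xx, pdE_X]
  · simp [pd, xx, pdO_X]
  · by_cases h : j = j'
    · subst h
      have e : (({j} : Finset (Fin n)).filter fun k => k < j) = ∅ := by
        ext l
        simp only [Finset.mem_filter, Finset.mem_singleton, Finset.notMem_empty, iff_false]
        rintro ⟨rfl, h⟩
        exact lt_irrefl _ h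
      simp [pd, xx, pdO_X, e]
    · simp [pd, xx, pdO_X, h]

lemma mul_one' (a : O F m n) : mulO F a (X F ((0 : Fin m → ℕ), (∅ : Finset (Fin n)))) = a := by
  have : (mulO F).flip (X F ((0 : Fin m → ℕ), (∅ : Finset (Fin n)))) = LinearMap.id := by
    apply lext
    intro μ
    simp [mulO_X, mulMono, invCount]
  exact congrArg (fun T => T a) this

lemma fD_xx (μ : Mono m n) (k l : Fin m ⊕ Fin n) :
    fD F μ k (xx F l) = if k = l then X F μ else 0 := by
  rw [fD, LinearMap.comp_apply, pd_xx]
  split_ifs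
  · exact mul_one' _
  · simp

lemma DC_xx {r : ℕ} {pr : Fin m ⊕ Fin n → Fin m ⊕ Fin n} (hinv : Function.Involutive pr)
    (f : O F m n) (i : Fin m ⊕ Fin n) :
    DC F r pr 1 f (xx F (pr i)) = ((tau r i : ℤ) : F) • pd F i f := by
  rw [DC1_apply2, Finset.sum_eq_single i]
  · rw [pd_xx, if_pos rfl, mul_one']
  · intro k _ hk
    rw [pd_xx, if_neg (fun h => hk (hinv.injective h))]
    simp
  · simp

lemma coef (μ : Mono m n) (hμ : μ ≠ (0, ∅)) : ∃ (i : Fin m ⊕ Fin n) (ν : Mono m n) (c : F),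
    dg ν + 1 = dg μ ∧ c ≠ 0 ∧ ∀ f, (pd F i f) ν = c * f μ := by
  obtain ⟨α, u⟩ := μ
  by_cases h : ∃ i, α i ≠ 0
  · obtain ⟨i, hi⟩ := h
    refine ⟨Sum.inl i, (Function.update α i (α i - 1), u), 1, ?_, one_ne_zero, ?_⟩
    · simp only [dg]
      have h1 := Finset.sum_update_of_mem (Finset.mem_univ i) α (α i - 1)
      have h2 := Finset.sum_update_of_mem (Finset.mem_univ i) α (α i)
      rw [Function.update_eq_self] at h2
      omega
    · intro f
      have : (Finsupp.lapply (Function.update α i (α i - 1), u)).comp (pd F (Sum.inl i)) =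
          (Finsupp.lapply (R := F) (M := F) ((α, u) : Mono m n)) := by
        apply lext
        rintro ⟨β, v⟩
        simp only [pd, Sum.elim_inl, LinearMap.comp_apply, pdE_X, Finsupp.lapply_apply]
        by_cases hb : β i = 0
        · simp only [hb, if_true, Finsupp.zero_apply, X]
          rw [Finsupp.single_apply, if_neg]
          intro e
          apply hi
          rw [← hb, (Prod.mk.inj e).1]
        · simp only [hb, if_false, X, Finsupp.single_apply, Prod.mk.injEq]
          congr 1
          apply propext
          apply and_congr_left
          intro _
          constructor
          · intro e
            ext l
            have e' := congrFun e l
            by_cases hl : l = i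
            · subst hl; simp at e'; omega
            · simpa [hl] using e'
          · rintro rfl; rfl
      rw [one_mul]
      exact congrArg (fun T => T f) this
  · push Not at h
    have hu : u.Nonempty := by
      by_contra hu
      apply hμ
      rw [Finset.not_nonempty_iff_eq_empty] at hu
      rw [hu]; congr 1; ext i; exact h i
    obtain ⟨j, hj⟩ := hu
    refine ⟨Sum.inr j, (α, u.erase j), (-1) ^ (u.filter fun k => k < j).card, ?_,
      pow_ne_zero _ (by simp), ?_⟩
    · simp only [dg]
      have := Finset.card_erase_add_one hj
      omega
    · intro f
      have : (Finsupp.lapply (α, u.erase j)).comp (pd F (Sum.inr j)) =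
          ((-1 : F) ^ (u.filter fun k => k < j).card) •
            (Finsupp.lapply (R := F) (M := F) ((α, u) : Mono m n)) := by
        apply lext
        rintro ⟨β, v⟩
        simp only [pd, Sum.elim_inr, LinearMap.comp_apply, pdO_X, Finsupp.lapply_apply,
          LinearMap.smul_apply]
        by_cases hb : j ∈ v
        · simp only [hb, if_true, X, Finsupp.smul_apply, Finsupp.single_apply, Prod.mk.injEq]
          by_cases huv : v = u
          · subst huv; simp
          · have : v.erase j ≠ u.erase j := by
              intro e; apply huv
              rw [← Finset.insert_erase hb, e, Finset.insert_erase hj]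
            simp [huv, this]
        · have : v ≠ u := fun e => hb (e ▸ hj)
          simp [hb, X, Finsupp.single_apply, this]
      exact congrArg (fun T => T f) this

lemma mul_par {e d : ℕ} {a b : O F m n} (ha : a ∈ Par F e) (hb : b ∈ Par F d) :
    mulO F a b ∈ Par F (e + d) := by
  refine Sp_map ((mulO F).flip b) _ (fun μ hμ => ?_) ha
  refine Sp_map (mulO F (X F μ)) _ (fun ν hν => ?_) hb
  rw [mulO_X, mulMono_eq]
  split_ifs with h
  · apply Submodule.smul_mem
    apply X_mem
    simp only [Finset.card_union_of_disjoint h]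
    omega
  · exact Submodule.zero_mem _

lemma inA_add {p : ℕ} (hp : p.Prime) [CharP F p] {t α β : Fin m → ℕ} (ha : inA p t α)
    (hb : inA p t β) (hw : (wt α β : F) ≠ 0) : inA p t (α + β) := by
  intro i
  by_contra h
  apply hw
  rw [CharP.cast_eq_zero_iff F p]
  refine dvd_trans ?_ (Finset.dvd_prod_of_mem _ (Finset.mem_univ i))
  have : Fact p.Prime := ⟨hp⟩
  simp only [Pi.add_apply, not_lt] at h
  have ht : t i ≠ 0 := by
    intro h0
    have h1 := ha i
    have h2 := hb i
    rw [h0, pow_zero] at h h1 h2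
    omega
  apply dvd_of_one_le_padicValNat
  rw [add_comm (α i) (β i),
    padicValNat_choose' (b := max (Nat.log p (β i + α i)) (t i) + 1) (by omega)]
  rw [Nat.one_le_iff_ne_zero, ← Nat.pos_iff_ne_zero, Finset.card_pos]
  refine ⟨t i, ?_⟩
  simp only [Finset.mem_filter, Finset.mem_Ico]
  rw [Nat.mod_eq_of_lt (ha i), Nat.mod_eq_of_lt (hb i)]
  refine ⟨⟨by omega, by omega⟩, by omega⟩

lemma mul_inA {p : ℕ} (hp : p.Prime) [CharP F p] {t : Fin m → ℕ} {a b : O F m n}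
    (ha : a ∈ Sp F (fun μ => inA p t μ.1)) (hb : b ∈ Sp F (fun μ => inA p t μ.1)) :
    mulO F a b ∈ Sp F (fun μ => inA p t μ.1) := by
  refine Sp_map ((mulO F).flip b) _ (fun μ hμ => ?_) ha
  refine Sp_map (mulO F (X F μ)) _ (fun ν hν => ?_) hb
  rw [mulO_X, mulMono_eq]
  split_ifs with h
  · by_cases hw : (wt μ.1 ν.1 : F) = 0
    · rw [hw]; simp
    · apply Submodule.smul_mem
      apply X_mem
      exact inA_add hp hμ hν hw
  · exact Submodule.zero_mem _

lemma pd_inA {p : ℕ} {t : Fin m → ℕ} {a : O F m n} (k : Fin m ⊕ Fin n)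
    (ha : a ∈ Sp F (fun μ => inA p t μ.1)) : pd F k a ∈ Sp F (fun μ => inA p t μ.1) := by
  refine Sp_map (pd F k) _ (fun μ hμ => ?_) ha
  rcases k with i | j
  · simp only [pd, Sum.elim_inl, pdE_X]
    split_ifs
    · simp
    · apply X_mem
      intro l
      by_cases hl : l = i
      · subst hl
        have := hμ l
        simp only [Function.update_self]
        omega
      · simpa [hl] using hμ l
  · simp only [pd, Sum.elim_inr, pdO_X]
    split_ifs with h
    · exact Submodule.smul_mem _ _ (X_mem hμ)
    · simp

/-- Even truncated part. -/
noncomputable abbrev OtE (F : Type) [Field F] {m n : ℕ} (p : ℕ) (t : Fin m → ℕ) :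
    Submodule F (O F m n) := Sp F (fun μ => inA p t μ.1 ∧ Even μ.2.card)

lemma OtE_par {p : ℕ} {t : Fin m → ℕ} {f : O F m n} (hf : f ∈ OtE F p t) : f ∈ Par F 0 :=
  Sp_mono (fun _ h => by rw [Nat.even_iff.1 h.2]) hf

lemma OtE_inA {p : ℕ} {t : Fin m → ℕ} {f : O F m n} (hf : f ∈ OtE F p t) :
    f ∈ Sp F (fun μ => inA p t μ.1) :=
  Sp_mono (fun _ h => h.1) hf

lemma OtE_bracket {p : ℕ} (hp : p.Prime) [CharP F p] {t : Fin m → ℕ} {r : ℕ}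
    {pr : Fin m ⊕ Fin n → Fin m ⊕ Fin n} (hpar : ∀ i, idxPar (pr i) = idxPar i)
    {f g : O F m n} (hf : f ∈ OtE F p t) (hg : g ∈ OtE F p t) :
    DC F r pr 1 f g ∈ OtE F p t := by
  have h1 : DC F r pr 1 f g ∈ Sp F (fun μ => inA p t μ.1) := by
    rw [DC1_apply2]
    exact Submodule.sum_mem _ fun i _ => Submodule.smul_mem _ _
      (mul_inA hp (pd_inA i (OtE_inA hf)) (pd_inA _ (OtE_inA hg)))
  have h2 : DC F r pr 1 f g ∈ Par F 0 := by
    rw [DC1_apply2]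
    refine Submodule.sum_mem _ fun i _ => Submodule.smul_mem _ _ ?_
    have := mul_par (pd_par i (OtE_par hf)) (pd_par (pr i) (OtE_par hg))
    rw [hpar] at this
    exact Sp_mono (fun _ h => by omega) this
  rw [mem_Sp] at h1 h2 ⊢
  exact fun μ hμ => ⟨h1 μ hμ, Nat.even_iff.2 (h2 μ hμ)⟩

lemma Delta_par (N : ℕ) (i : Fin m) {f : O F m n} (hf : f ∈ Par F 0) :
    ((pdE F i : Module.End F (O F m n)) ^ N) f ∈ Par F 0 := by
  induction N with
  | zero => simpa using hf
  | succ N ih =>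
    rw [pow_succ', Module.End.mul_apply]
    exact pd_par (Sum.inl i) ih

lemma Delta_X (N : ℕ) (i : Fin m) (μ : Mono m n) :
    ((pdE F i : Module.End F (O F m n)) ^ N) (X F μ) =
      if N ≤ μ.1 i then X F (Function.update μ.1 i (μ.1 i - N), μ.2) else 0 := by
  induction N with
  | zero => simp
  | succ N ih =>
    rw [pow_succ', Module.End.mul_apply, ih]
    by_cases h : N ≤ μ.1 i
    · rw [if_pos h, pdE_X]
      simp only [Function.update_self, Function.update_idem]
      by_cases h' : N + 1 ≤ μ.1 i
      · rw [if_pos h', if_neg (by omega), Nat.sub_sub]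
      · rw [if_neg h', if_pos (by omega)]
    · rw [if_neg h, if_neg (by omega), map_zero]

lemma exists_factor {U V W : Type} [AddCommGroup U] [Module F U] [AddCommGroup V] [Module F V]
    [AddCommGroup W] [Module F W] (A : U →ₗ[F] V) (B : U →ₗ[F] W)
    (h : ∀ u, A u = 0 → B u = 0) : ∃ g : V →ₗ[F] W, ∀ u, g (A u) = B u := by
  obtain ⟨s, hs⟩ := LinearMap.exists_rightInverse_of_surjective A.rangeRestrict
    (LinearMap.range_rangeRestrict A)
  obtain ⟨g, hg⟩ := LinearMap.exists_extend (B.comp s)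
  refine ⟨g, fun u => ?_⟩
  have h1 : g (A u) = B (s (A.rangeRestrict u)) := congrArg (fun T => T (A.rangeRestrict u)) hg
  rw [h1, ← sub_eq_zero, ← map_sub]
  apply h
  rw [map_sub, sub_eq_zero]
  exact congrArg Subtype.val (congrArg (fun T => T (A.rangeRestrict u)) hs)

lemma abs_final {R : Type} [Ring R] (x y w a b A B : R) (hx : x * w = w * x) (hy : y * w = w * y)
    (hb : x * b = B + b * x) (ha : y * a = A + a * y) :
    (a * w * y - y * (a * w)) + (x * (b * w) - b * w * x) = (B - A) * w := by
  rw [mul_assoc a, ← hy, mul_assoc b, ← hx, ← mul_assoc y, ← mul_assoc x, ha, hb]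
  noncomm_ring

lemma ker_const {r : ℕ} {pr : Fin m ⊕ Fin n → Fin m ⊕ Fin n} (hinv : Function.Involutive pr)
    (htau0 : ∀ i : Fin m ⊕ Fin n, ((tau r i : ℤ) : F) ≠ 0) {P : Mono m n → Prop} {f : O F m n}
    (h : ∀ i, DC F r pr 1 f (xx F (pr i)) ∈ Sp F P) (μ : Mono m n) (hμ : μ ≠ (0, ∅))
    (hf : f μ ≠ 0) : ∃ ν, P ν ∧ dg ν + 1 = dg μ := by
  obtain ⟨i, ν, c, h1, h2, h3⟩ := coef (F := F) μ hμ
  refine ⟨ν, ?_, h1⟩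
  have := h i
  rw [DC_xx hinv, mem_Sp] at this
  apply this
  rw [Finsupp.smul_apply, h3, smul_eq_mul]
  exact mul_ne_zero (htau0 i) (mul_ne_zero h2 hf)

end final
end HamSup

namespace HamSup

section final2
set_option linter.unusedSimpArgs false
variable {F : Type} [Field F] {m n : ℕ}

/-- The map `f ↦ ∂_i^N(f) D_H(x^ω)`. -/
noncomputable def Psi (F : Type) [Field F] {m n : ℕ} (r : ℕ)
    (pr : Fin m ⊕ Fin n → Fin m ⊕ Fin n) (N : ℕ) (i : Fin m) :
    O F m n →ₗ[F] Module.End F (O F m n) :=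
  (LinearMap.mulRight F (DHmono F r pr ((0 : Fin m → ℕ), (Finset.univ : Finset (Fin n))))).comp
    ((mulO F).comp ((pdE F i : Module.End F (O F m n)) ^ N))

lemma Psi_apply (r : ℕ) (pr : Fin m ⊕ Fin n → Fin m ⊕ Fin n) (N : ℕ) (i : Fin m)
    (f : O F m n) : Psi F r pr N i f =
      (mulO F (((pdE F i : Module.End F (O F m n)) ^ N) f) : Module.End F (O F m n)) *
        DHmono F r pr ((0 : Fin m → ℕ), (Finset.univ : Finset (Fin n))) := rfl

lemma Psi_mem (r : ℕ) (prE : Fin m → Fin m) (prO : Fin n → Fin n) (N : ℕ) (i : Fin m)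
    (S : Submodule F (Module.End F (O F m n))) (μ : Mono m n)
    (h : ∀ (ρ : Mono m n) (j : Fin n), N ≤ μ.1 i →
      ρ.1 = Function.update μ.1 i (μ.1 i - N) → ρ.2.card + 1 = μ.2.card + n →
      fD F ρ (Sum.inr j) ∈ S) :
    Psi F r (Sum.map prE prO) N i (X F μ) ∈ S := by
  rw [Psi_apply, Delta_X]
  split_ifs with hN
  swap
  · rw [map_zero, zero_mul]; exact S.zero_mem
  set α := Function.update μ.1 i (μ.1 i - N) with hα
  have key : DHmono F r (Sum.map prE prO) ((0 : Fin m → ℕ), (Finset.univ : Finset (Fin n))) ∈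
      S.comap (LinearMap.mulLeft F (mulO F (X F (α, μ.2)) : Module.End F (O F m n))) := by
    rw [DHmono]
    refine Submodule.sum_mem _ fun k _ => Submodule.smul_mem _ _ ?_
    rcases k with k | j
    · simp [pd, pdE_X]
    · simp only [pd, Sum.elim_inr, pdO_X, Finset.mem_univ, if_true, map_smul, LinearMap.smul_comp]
      refine Submodule.smul_mem _ _ ?_
      rw [Submodule.mem_comap, LinearMap.mulLeft_apply]
      change (mulO F (X F (α, μ.2)) : Module.End F (O F m n)) *
        ((mulO F (X F ((0 : Fin m → ℕ), (Finset.univ : Finset (Fin n)).erase j)) :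
          Module.End F (O F m n)) * pdO F (prO j)) ∈ S
      rw [← mul_assoc, ← L_mul, mulO_X, mulMono_eq]
      split_ifs with hd
      swap
      · rw [map_zero, zero_mul]; exact S.zero_mem
      rw [map_smul, smul_mul_assoc]
      refine Submodule.smul_mem _ _ ?_
      refine h (α + 0, μ.2 ∪ (Finset.univ : Finset (Fin n)).erase j) (prO j) hN (by simp) ?_
      simp only [Finset.card_union_of_disjoint hd]
      have := Finset.card_erase_add_one (Finset.mem_univ j)
      rw [Finset.card_univ, Fintype.card_fin] at this
      omega
  exact key

lemma inA_upd {p : ℕ} {t α : Fin m → ℕ} (h : inA p t α) (i : Fin m) (N : ℕ) :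
    inA p t (Function.update α i (α i - N)) := by
  intro l
  by_cases hl : l = i
  · subst hl
    have := h l
    simp only [Function.update_self]
    omega
  · simpa [hl] using h l

lemma H0_form {p r : ℕ} {t : Fin m → ℕ}
    {pr : Fin m ⊕ Fin n → Fin m ⊕ Fin n} {x : Module.End F (O F m n)} (hx : x ∈ H0 F p r t pr) :
    ∃ f ∈ OtE F p t, x = DC F r pr 1 f := by
  have : H0 F p r t pr ≤ (OtE F p t).map (DC F r pr 1) := by
    apply Submodule.span_le.2
    rintro _ ⟨μ, h1, h2, _, rfl⟩
    exact ⟨X F μ, X_mem ⟨h1, h2⟩, (DHmono_even h2).symm⟩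
  obtain ⟨f, hf, e⟩ := this hx
  exact ⟨f, hf, e.symm⟩

lemma Wcomp_xx {p : ℕ} {t : Fin m → ℕ} {k : ℤ} {x : Module.End F (O F m n)}
    (hx : x ∈ Wcomp F p t k) (l : Fin m ⊕ Fin n) :
    x (xx F l) ∈ Sp F (fun ν : Mono m n => (dg ν : ℤ) - 1 = k) := by
  have : Wcomp F p t k ≤ (Sp F (fun ν : Mono m n => (dg ν : ℤ) - 1 = k)).comap
      (LinearMap.applyₗ (xx F l)) := by
    apply Submodule.span_le.2
    rintro _ ⟨μ, j, _, h2, rfl⟩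
    change fD F μ j (xx F l) ∈ Sp F (fun ν : Mono m n => (dg ν : ℤ) - 1 = k)
    rw [fD_xx]
    split_ifs
    · apply X_mem
      rw [dg]; push_cast at h2 ⊢; exact h2
    · exact Submodule.zero_mem _
  exact this hx

lemma Psi_const {r : ℕ} {pr : Fin m ⊕ Fin n → Fin m ⊕ Fin n} {N : ℕ} (hN : 0 < N) (i : Fin m) :
    Psi F r pr N i (X F (0, ∅)) = 0 := by
  rw [Psi_apply, Delta_X, if_neg (by simpa using hN.ne'), map_zero, zero_mul]

lemma Psi_W1 {p r s : ℕ} (hn : n = 2 * s + 1) {t : Fin m → ℕ} (prE : Fin m → Fin m)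
    (prO : Fin n → Fin n) (N : ℕ) (i : Fin m) {f : O F m n} (hf : f ∈ OtE F p t) :
    Psi F r (Sum.map prE prO) N i f ∈ W1 F p t := by
  refine Sp_map _ _ (fun μ hμ => ?_) hf
  apply Psi_mem
  intro ρ j _ h1 h2
  refine Submodule.subset_span ⟨ρ, Sum.inr j, ?_, ?_, rfl⟩
  · rw [h1]; exact inA_upd hμ.1 i N
  · obtain ⟨c, hc⟩ := hμ.2
    simp only [idxPar, Sum.elim_inr]
    exact ⟨c + s, by omega⟩

lemma Psi_Wcomp {p r : ℕ} {t : Fin m → ℕ} (prE : Fin m → Fin m)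
    (prO : Fin n → Fin n) {N : ℕ} (hN : 0 < N) (i : Fin m) {k : ℤ} {f : O F m n}
    (hf : f ∈ OtE F p t) (hf2 : ∀ μ : Mono m n, μ ≠ (0, ∅) → f μ ≠ 0 → (dg μ : ℤ) = k + 2) :
    Psi F r (Sum.map prE prO) N i f ∈ Wcomp F p t (k + (n : ℤ) - (N : ℤ)) := by
  have hf3 : f ∈ Sp F (fun μ : Mono m n => inA p t μ.1 ∧ (μ = (0, ∅) ∨ (dg μ : ℤ) = k + 2)) := by
    rw [mem_Sp] at hf ⊢
    intro μ hμ
    refine ⟨(hf μ hμ).1, ?_⟩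
    by_cases h0 : μ = (0, ∅)
    · exact Or.inl h0
    · exact Or.inr (hf2 μ h0 hμ)
  refine Sp_map _ _ (fun μ hμ => ?_) hf3
  obtain ⟨h1, h2⟩ := hμ
  rcases h2 with rfl | h2
  · rw [Psi_const hN]; exact Submodule.zero_mem _
  apply Psi_mem
  intro ρ j hle e1 e2
  refine Submodule.subset_span ⟨ρ, Sum.inr j, ?_, ?_, rfl⟩
  · rw [e1]; exact inA_upd h1 i N
  · have a1 := Finset.sum_update_of_mem (Finset.mem_univ i) μ.1 (μ.1 i - N)
    have a2 := Finset.sum_update_of_mem (Finset.mem_univ i) μ.1 (μ.1 i)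
    rw [Function.update_eq_self] at a2
    rw [e1]
    rw [dg] at h2
    have a3 : (∑ l, Function.update μ.1 i (μ.1 i - N) l) + N = ∑ l, μ.1 l := by omega
    zify at a3 e2
    push_cast at h2 ⊢
    linarith

lemma Psi_der {p r : ℕ} (hp : p.Prime) [CharP F p] (h2 : (2 : F) ≠ 0)
    {pr : Fin m ⊕ Fin n → Fin m ⊕ Fin n} (hpar : ∀ i, idxPar (pr i) = idxPar i)
    (hinv : Function.Involutive pr)
    (htau : ∀ i, ((tau r (pr i) : ℤ) : F) = - ((-1) ^ idxPar i * ((tau r i : ℤ) : F)))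
    (htau1 : ∀ i : Fin m ⊕ Fin n, idxPar i = 1 → tau r i = 1) (q : ℕ) (i : Fin m)
    {f g : O F m n} (hf : f ∈ Par F 0) (hg : g ∈ Par F 0) :
    Psi F r pr (p ^ q) i (DC F r pr 1 f g) =
      ⁅Psi F r pr (p ^ q) i f, DC F r pr 1 g⁆ + ⁅DC F r pr 1 f, Psi F r pr (p ^ q) i g⁆ := by
  set w := DHmono F r pr ((0 : Fin m → ℕ), (Finset.univ : Finset (Fin n))) with hw
  have hwc : ∀ f ∈ Par F (m := m) (n := n) 0, DC F r pr 1 f * w = w * DC F r pr 1 f := by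
    intro f hf
    have hom : om F m n ∈ Par F (Finset.univ : Finset (Fin n)).card := X_mem rfl
    have := main_bracket hpar hinv htau hf hom
    rw [D_om h2 hinv hpar htau1 hf, map_zero] at this
    have e : w = DC F r pr ((-1) ^ (Finset.univ : Finset (Fin n)).card) (om F m n) := DHmono_eq _
    rw [e]
    exact sub_eq_zero.1 this
  have hΔf := Delta_par (p ^ q) i hf
  have hΔg := Delta_par (p ^ q) i hg
  have hb := stepB (r := r) hpar hf hΔg
  have ha := stepB (r := r) hpar hg hΔf
  have := abs_final _ _ w _ _ _ _ (hwc f hf) (hwc g hg) hb ha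
  rw [Psi_apply, Delta_D p hp, antisymm hpar hinv htau hΔf hg]
  refine Eq.trans ?_ this.symm
  rw [neg_add_eq_sub, map_sub]

lemma DC_inj {r : ℕ} {pr : Fin m ⊕ Fin n → Fin m ⊕ Fin n} (hinv : Function.Involutive pr)
    (htau0 : ∀ i : Fin m ⊕ Fin n, ((tau r i : ℤ) : F) ≠ 0) {f : O F m n}
    (h : DC F r pr 1 f = 0) {N : ℕ} (hN : 0 < N) (i : Fin m) : Psi F r pr N i f = 0 := by
  have hf : f ∈ Sp F (fun μ : Mono m n => μ = (0, ∅)) := by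
    rw [mem_Sp]
    intro μ hμ
    by_contra h0
    obtain ⟨_, hF, _⟩ := ker_const hinv htau0 (P := fun _ => False)
      (fun i => by rw [h]; exact Submodule.zero_mem _) μ h0 hμ
    exact hF
  have := Sp_map (Psi F r pr N i) ⊥ (fun μ hμ => by rw [hμ, Psi_const hN]; exact Submodule.zero_mem _) hf
  simpa using this

end final2
end HamSup


open HamSup in
/-- for `n` odd, `Φ_i^(q) : D_H(f) ↦ ∂_i^(p^q)(f) · D_H(x^ω)` is a well-defined
derivation `H₀̄ → W₁̄` of `ℤ`-degree `n − p^q`. -/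
theorem Phi_derivation (F : Type) [Field F] (m n p : ℕ) (hp : p.Prime) (h3 : 3 < p)
    (hchar : ringChar F = p) (r s : ℕ) (hm : m = 2 * r) (hn : n = 2 * s + 1)
    (t : Fin m → ℕ) (ht : ∀ i, 0 < t i)
    (prE : Fin m → Fin m)
    (hprE : ∀ i : Fin m, (prE i : ℕ) = if (i : ℕ) < r then (i : ℕ) + r else (i : ℕ) - r)
    (prO : Fin n → Fin n)
    (hprO : ∀ j : Fin n, (prO j : ℕ) =
      if (j : ℕ) < s then (j : ℕ) + s else if (j : ℕ) < 2 * s then (j : ℕ) - s else (j : ℕ)) (i : Fin m) (q : ℕ) :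
    ∃ φ : Module.End F (O F m n) →ₗ[F] Module.End F (O F m n),
      (∀ μ : Mono m n, inA p t μ.1 → Even μ.2.card →
        ¬(μ.1 = piF p t ∧ μ.2 = Finset.univ) →
        φ (DHmono F r (Sum.map prE prO) μ) =
          (mulO F (((pdE F i : Module.End F (O F m n)) ^ p ^ q) (X F μ))).comp (DHmono F r (Sum.map prE prO) ((0 : Fin m → ℕ), (Finset.univ : Finset (Fin n))))) ∧
      (∀ x, x ∈ H0 F p r t (Sum.map prE prO) → φ x ∈ W1 F p t) ∧
      (∀ x, x ∈ H0 F p r t (Sum.map prE prO) → ∀ y, y ∈ H0 F p r t (Sum.map prE prO) →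
      φ ⁅x, y⁆ = ⁅φ x, y⁆ + ⁅x, φ y⁆) ∧
      (∀ k : ℤ, ∀ x, x ∈ H0 F p r t (Sum.map prE prO) → x ∈ Wcomp F p t k →
        φ x ∈ Wcomp F p t (k + (n : ℤ) - ((p ^ q : ℕ) : ℤ))) := by
  have hcp : CharP F p := ringChar.of_eq hchar
  have h2 : (2 : F) ≠ 0 := by
    intro h
    have : ((2 : ℕ) : F) = 0 := by exact_mod_cast h
    rw [CharP.cast_eq_zero_iff F p] at this
    have := Nat.le_of_dvd (by norm_num) this
    omega
  have hpar : ∀ i, idxPar (Sum.map prE prO i) = idxPar i := by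
    rintro (i | j) <;> rfl
  have hinv : Function.Involutive (Sum.map prE prO) := by
    rintro (i | j)
    · simp only [Sum.map_inl, Sum.inl.injEq]
      apply Fin.ext
      have h1 := hprE (prE i)
      have h2 := hprE i
      have h3 := i.2
      split_ifs at h1 h2 <;> omega
    · simp only [Sum.map_inr, Sum.inr.injEq]
      apply Fin.ext
      have h1 := hprO (prO j)
      have h2 := hprO j
      have h3 := j.2
      split_ifs at h1 h2 <;> omega
  have htau : ∀ i, ((tau r (Sum.map prE prO i) : ℤ) : F) =
      - ((-1) ^ idxPar i * ((tau r i : ℤ) : F)) := by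
    rintro (i | j)
    · have h2 := hprE i
      have h3 := i.2
      by_cases hi : (i : ℕ) < r
      · rw [if_pos hi] at h2
        have : ¬ (prE i : ℕ) < r := by omega
        simp [tau, idxPar, hi, this]
      · rw [if_neg hi] at h2
        have : (prE i : ℕ) < r := by omega
        simp [tau, idxPar, hi, this]
    · simp [tau, idxPar]
  have htau1 : ∀ i : Fin m ⊕ Fin n, idxPar i = 1 → tau r i = 1 := by
    rintro (i | j) h
    · simp [idxPar] at h
    · rfl
  have htau0 : ∀ i : Fin m ⊕ Fin n, ((tau r i : ℤ) : F) ≠ 0 := by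
    rintro (i | j)
    · by_cases hi : (i : ℕ) < r <;> simp [tau, hi]
    · simp [tau]
  have hN : 0 < p ^ q := pow_pos hp.pos q
  let A : OtE F (n := n) p t →ₗ[F] Module.End F (O F m n) :=
    (DC F r (Sum.map prE prO) 1).comp (OtE F p t).subtype
  let B : OtE F (n := n) p t →ₗ[F] Module.End F (O F m n) :=
    (Psi F r (Sum.map prE prO) (p ^ q) i).comp (OtE F p t).subtype
  have hAB : ∀ u, A u = 0 → B u = 0 := fun u hu => DC_inj hinv htau0 hu hN i
  obtain ⟨φ, hφ⟩ := exists_factor (U := OtE F (m := m) (n := n) p t)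
    (V := Module.End F (O F m n)) (W := Module.End F (O F m n)) A B hAB
  have hφ1 : ∀ f ∈ OtE F p t, φ (DC F r (Sum.map prE prO) 1 f) =
      Psi F r (Sum.map prE prO) (p ^ q) i f := fun f hf => hφ ⟨f, hf⟩
  refine ⟨φ, ?_, ?_, ?_, ?_⟩
  · intro μ h1 h2 _
    rw [DHmono_even h2, hφ1 _ (X_mem ⟨h1, h2⟩)]
    rfl
  · intro x hx
    obtain ⟨f, hf, rfl⟩ := H0_form hx
    rw [hφ1 f hf]
    exact Psi_W1 hn prE prO _ i hf
  · intro x hx y hy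
    obtain ⟨f, hf, rfl⟩ := H0_form hx
    obtain ⟨g, hg, rfl⟩ := H0_form hy
    have hb : ⁅DC F r (Sum.map prE prO) 1 f, DC F r (Sum.map prE prO) 1 g⁆ =
        DC F r (Sum.map prE prO) 1 (DC F r (Sum.map prE prO) 1 f g) := by
      have := main_bracket hpar hinv htau (OtE_par hf) (e := 0) (OtE_par hg)
      simp only [pow_zero] at this
      exact this
    rw [hb, hφ1 _ (OtE_bracket hp hpar hf hg), hφ1 f hf, hφ1 g hg]
    exact Psi_der hp h2 hpar hinv htau htau1 q i (OtE_par hf) (OtE_par hg)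
  · intro k x hx hk
    obtain ⟨f, hf, rfl⟩ := H0_form hx
    rw [hφ1 f hf]
    refine Psi_Wcomp prE prO hN i hf ?_
    intro μ h0 hμ
    obtain ⟨ν, h1, h2⟩ := ker_const hinv htau0 (fun l => Wcomp_xx hk _) μ h0 hμ
    omega
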